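/- arXiv:2208.00779 — 4 statements merged into one kernel-verified Lean document; each statement's English description precedes it below -/
import Mathlib

section
/- Let n ≥ 2, E a finite set of ordered pairs (i,j) with i ≠ j, weights λ_{ij} ≥ 0, and Λ = Σ_{(i,j)∈E} λ_{ij}(e_i−e_j)(e_i−e_j)ᵀ, and assume the kernel of Λ is exactly the span of 𝟙 (connected graph). Define χ₂[Λ] = (1/2)·sup_{(i,j)∈E}(e_i−e_j)ᵀΛ⁺(e_i−e_j). Then n−1 ≤ χ₂[Λ]·Tr(Λ); equivalently χ₂[Λ] ≥ (n−1)/Tr(Λ). -/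
open Matrix BigOperators

noncomputable section

/-- The vector `e_i - e_j` in `ℝⁿ`. -/
def gVec (n : ℕ) (i j : Fin n) : Fin n → ℝ :=
  fun k => (if k = i then (1 : ℝ) else 0) - (if k = j then (1 : ℝ) else 0)

/-- The expected gossip matrix `Λ = Σ_{(i,j)∈E} λ_{ij} (e_i-e_j)(e_i-e_j)ᵀ`. -/
def gMat (n : ℕ) (E : Finset (Fin n × Fin n)) (lam : Fin n × Fin n → ℝ) :
    Matrix (Fin n) (Fin n) ℝ :=
  ∑ p ∈ E, lam p • Matrix.vecMulVec (gVec n p.1 p.2) (gVec n p.1 p.2)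

/-- `B` is the Moore–Penrose pseudoinverse of `A`. -/
def IsMPInv {n : ℕ} (A B : Matrix (Fin n) (Fin n) ℝ) : Prop :=
  A * B * A = A ∧ B * A * B = B ∧ (A * B)ᵀ = A * B ∧ (B * A)ᵀ = B * A

/-- `χ₂[Λ] = (1/2)·sup_{(i,j)∈E} (e_i-e_j)ᵀ Λ⁺ (e_i-e_j)`, expressed in terms of the
pseudoinverse `Λp` of `Λ`. -/
def chi2 (n : ℕ) (E : Finset (Fin n × Fin n)) (Λp : Matrix (Fin n) (Fin n) ℝ) : ℝ :=
  (1 / 2) * sSup {r : ℝ | ∃ p ∈ E, r = gVec n p.1 p.2 ⬝ᵥ (Λp *ᵥ gVec n p.1 p.2)}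

theorem gVec_dotProduct_self {n : ℕ} {i j : Fin n} (h : i ≠ j) :
    gVec n i j ⬝ᵥ gVec n i j = 2 := by
  have h' : gVec n i j = Pi.single i 1 - Pi.single j 1 := by
    ext k
    simp [gVec, Pi.single_apply]
  rw [h']
  simp [h, h.symm]
  norm_num

theorem trace_gMat {n : ℕ} {E : Finset (Fin n × Fin n)} (hE : ∀ p ∈ E, p.1 ≠ p.2)
    (lam : Fin n × Fin n → ℝ) : (gMat n E lam).trace = 2 * ∑ p ∈ E, lam p := by
  rw [gMat, trace_sum, Finset.mul_sum]
  refine Finset.sum_congr rfl fun p hp => ?_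
  rw [trace_smul, trace_vecMulVec, gVec_dotProduct_self (hE p hp), smul_eq_mul, mul_comm]

theorem trace_mul_gMat {n : ℕ} (B : Matrix (Fin n) (Fin n) ℝ) (E : Finset (Fin n × Fin n))
    (lam : Fin n × Fin n → ℝ) :
    (B * gMat n E lam).trace =
      ∑ p ∈ E, lam p * (gVec n p.1 p.2 ⬝ᵥ (B *ᵥ gVec n p.1 p.2)) := by
  rw [gMat, Matrix.mul_sum, trace_sum]
  refine Finset.sum_congr rfl fun p _ => ?_
  rw [Matrix.mul_smul, trace_smul, mul_vecMulVec, trace_vecMulVec, smul_eq_mul, dotProduct_comm]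

/-- If the kernel of `A` consists of the constant vectors and `B` is a generalized inverse of `A`,
then `B * A` has trace `n - 1`. -/
theorem trace_mul_eq_sub_one {n : ℕ} (hn : 0 < n) {A B : Matrix (Fin n) (Fin n) ℝ}
    (hker : ∀ x : Fin n → ℝ, A *ᵥ x = 0 ↔ ∃ c : ℝ, x = fun _ => c) (h : A * B * A = A) :
    (B * A).trace = n - 1 := by
  set Q : Matrix (Fin n) (Fin n) ℝ := 1 - B * A with hQ
  have hAQ : A * Q = 0 := by
    rw [hQ, Matrix.mul_sub, Matrix.mul_one, ← Matrix.mul_assoc, h, sub_self]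
  have hcol (j : Fin n) : ∃ c : ℝ, Q.col j = fun _ => c := by
    rw [← hker, ← Matrix.mulVec_single_one, Matrix.mulVec_mulVec, hAQ, Matrix.zero_mulVec]
  choose c hc using hcol
  have hc' (i j : Fin n) : Q i j = c j := congrFun (hc j) i
  have hQ1 : Q *ᵥ 1 = 1 := by
    have : A *ᵥ 1 = 0 := (hker 1).2 ⟨1, rfl⟩
    rw [hQ, Matrix.sub_mulVec, Matrix.one_mulVec, ← Matrix.mulVec_mulVec, this,
      Matrix.mulVec_zero, sub_zero]
  have htr : Q.trace = 1 := by
    have := congrFun hQ1 ⟨0, hn⟩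
    simpa [Matrix.mulVec, dotProduct, Matrix.trace, hc'] using this
  rw [hQ, trace_sub, trace_one, Fintype.card_fin] at htr
  linarith

theorem stmt4 (n : ℕ) (hn : 2 ≤ n) (E : Finset (Fin n × Fin n))
    (hE : ∀ p ∈ E, p.1 ≠ p.2) (lam : Fin n × Fin n → ℝ)
    (hlam : ∀ p ∈ E, 0 ≤ lam p) (Λp : Matrix (Fin n) (Fin n) ℝ)
    (hker : ∀ x : Fin n → ℝ, gMat n E lam *ᵥ x = 0 ↔ ∃ c : ℝ, x = fun _ => c)
    (hmp : IsMPInv (gMat n E lam) Λp) :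
    (n : ℝ) - 1 ≤ chi2 n E Λp * (gMat n E lam).trace := by
  have htr := trace_mul_eq_sub_one (by omega) hker hmp.1
  rw [← htr, trace_mul_gMat, trace_gMat hE, chi2]
  set S : Set ℝ := {r : ℝ | ∃ p ∈ E, r = gVec n p.1 p.2 ⬝ᵥ (Λp *ᵥ gVec n p.1 p.2)} with hS
  have hfin : S.Finite := by
    refine (E.finite_toSet.image fun p => gVec n p.1 p.2 ⬝ᵥ (Λp *ᵥ gVec n p.1 p.2)).subset ?_
    rintro r ⟨p, hp, rfl⟩
    exact ⟨p, hp, rfl⟩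
  calc ∑ p ∈ E, lam p * (gVec n p.1 p.2 ⬝ᵥ (Λp *ᵥ gVec n p.1 p.2))
      ≤ ∑ p ∈ E, lam p * sSup S := Finset.sum_le_sum fun p hp =>
        mul_le_mul_of_nonneg_left (le_csSup hfin.bddAbove ⟨p, hp, rfl⟩) (hlam p hp)
    _ = 1 / 2 * sSup S * (2 * ∑ p ∈ E, lam p) := by rw [← Finset.sum_mul]; ring
end
end

section
/- Let n ≥ 2, d ≥ 1, let f_1,…,f_n : ℝ^d → ℝ each be μ-strongly convex, and let 0 < ν < μ. Let π act blockwise on (ℝ^d)ⁿ by (πX)_i = X_i − (1/n)Σ_k X_k. Then (as an identity of extended reals) inf_{x ∈ ℝ^d} Σ_{i=1}^n f_i(x) = inf over X ∈ (ℝ^d)ⁿ of the sup over Y, Z ∈ (ℝ^d)ⁿ of [Σ_{i=1}^n f_i(X_i) − (ν/2)‖X‖² − ⟨X,Y⟩ − (1/(2ν))‖πZ + Y‖²]. -/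
open BigOperators

noncomputable section

/-- The standard inner product on `(ℝ^d)ⁿ`, `⟨A,B⟩ = Σ_i Σ_k A i k * B i k`. -/
def ipnd (n d : ℕ) (A B : Fin n → Fin d → ℝ) : ℝ :=
  ∑ i, ∑ k, A i k * B i k

/-- The blockwise centering operator `(πX)_i = X_i - (1/n) Σ_k X_k`. -/
def blockPi (n d : ℕ) (A : Fin n → Fin d → ℝ) : Fin n → Fin d → ℝ :=
  fun i => A i - ((n : ℝ))⁻¹ • ∑ j, A j

theorem ipnd_self_nonneg (n d : ℕ) (A : Fin n → Fin d → ℝ) : 0 ≤ ipnd n d A A :=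
  Finset.sum_nonneg fun _ _ => Finset.sum_nonneg fun _ _ => mul_self_nonneg _

theorem eq_zero_of_ipnd_self_eq_zero {n d : ℕ} {A : Fin n → Fin d → ℝ}
    (h : ipnd n d A A = 0) : A = 0 := by
  have hrow := (Finset.sum_eq_zero_iff_of_nonneg fun _ _ =>
    Finset.sum_nonneg fun _ _ => mul_self_nonneg _).1 h
  ext i k
  exact mul_self_eq_zero.1 ((Finset.sum_eq_zero_iff_of_nonneg fun _ _ => mul_self_nonneg _).1
    (hrow i (Finset.mem_univ i)) k (Finset.mem_univ k))

theorem ipnd_zero_zero (n d : ℕ) : ipnd n d 0 0 = 0 := by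
  simp [ipnd]

theorem ipnd_smul_right (n d : ℕ) (t : ℝ) (A B : Fin n → Fin d → ℝ) :
    ipnd n d A (t • B) = t * ipnd n d A B := by
  simp only [ipnd, Pi.smul_apply, smul_eq_mul, Finset.mul_sum]
  exact Finset.sum_congr rfl fun _ _ => Finset.sum_congr rfl fun _ _ => by ring

theorem blockPi_smul (n d : ℕ) (t : ℝ) (A : Fin n → Fin d → ℝ) :
    blockPi n d (t • A) = t • blockPi n d A := by
  ext i k
  simp only [blockPi, Pi.smul_apply, Pi.sub_apply, Finset.sum_apply, smul_eq_mul,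
    ← Finset.mul_sum]
  ring

theorem sum_blockPi {n d : ℕ} (hn : n ≠ 0) (A : Fin n → Fin d → ℝ) :
    ∑ i, blockPi n d A i = 0 := by
  have hn' : (n : ℝ) ≠ 0 := Nat.cast_ne_zero.2 hn
  simp [blockPi, Finset.sum_sub_distrib, ← Nat.cast_smul_eq_nsmul ℝ, smul_smul, hn']

theorem ipnd_const_blockPi {n d : ℕ} (hn : n ≠ 0) (x : Fin d → ℝ)
    (A : Fin n → Fin d → ℝ) : ipnd n d (fun _ => x) (blockPi n d A) = 0 := by
  have h (k : Fin d) : ∑ i, blockPi n d A i k = 0 := by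
    simpa using congrFun (sum_blockPi hn A) k
  rw [ipnd, Finset.sum_comm]
  simp [← Finset.mul_sum, h]

theorem ipnd_blockPi_self {n d : ℕ} (hn : n ≠ 0) (A : Fin n → Fin d → ℝ) :
    ipnd n d A (blockPi n d A) = ipnd n d (blockPi n d A) (blockPi n d A) := by
  have h := ipnd_const_blockPi hn ((n : ℝ)⁻¹ • ∑ j, A j) A
  rw [← sub_eq_zero, ← h]
  simp only [ipnd, ← Finset.sum_sub_distrib]
  refine Finset.sum_congr rfl fun i _ => Finset.sum_congr rfl fun k _ => ?_
  simp only [blockPi, Pi.sub_apply]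
  ring

/-- Completing the square in `Y`. -/
theorem ipnd_complete_square (n d : ℕ) {ν : ℝ} (hν : ν ≠ 0) (a : ℝ)
    (X Y W : Fin n → Fin d → ℝ) :
    a - (ν / 2) * ipnd n d X X - ipnd n d X Y - (1 / (2 * ν)) * ipnd n d (W + Y) (W + Y) =
      a + ipnd n d X W -
        (1 / (2 * ν)) * ipnd n d (W + Y + ν • X) (W + Y + ν • X) := by
  suffices h : (ν / 2) * ipnd n d X X + ipnd n d X Y +
      (1 / (2 * ν)) * ipnd n d (W + Y) (W + Y) + ipnd n d X W =
      (1 / (2 * ν)) * ipnd n d (W + Y + ν • X) (W + Y + ν • X) by linarith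
  simp only [ipnd, Finset.mul_sum, ← Finset.sum_add_distrib]
  refine Finset.sum_congr rfl fun i _ => Finset.sum_congr rfl fun k _ => ?_
  simp only [Pi.add_apply, Pi.smul_apply, smul_eq_mul]
  field_simp
  ring

theorem stmt13 (n d : ℕ) (hn : 2 ≤ n) (hd : 1 ≤ d) (μ ν : ℝ)
    (hν : 0 < ν) (hνμ : ν < μ)
    (f : Fin n → (Fin d → ℝ) → ℝ)
    (hconv : ∀ i, ConvexOn ℝ Set.univ (fun x : Fin d → ℝ => f i x - (μ / 2) * ∑ k, (x k) ^ 2)) :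
    (⨅ x : Fin d → ℝ, ((∑ i, f i x : ℝ) : EReal)) =
      ⨅ X : Fin n → Fin d → ℝ, ⨆ Y : Fin n → Fin d → ℝ, ⨆ Z : Fin n → Fin d → ℝ,
        (((∑ i, f i (X i)) - (ν / 2) * ipnd n d X X - ipnd n d X Y -
            (1 / (2 * ν)) * ipnd n d (blockPi n d Z + Y) (blockPi n d Z + Y) : ℝ) : EReal) := by
  have hn0 : n ≠ 0 := by omega
  apply le_antisymm
  · refine le_iInf fun X => ?_
    let x := (n : ℝ)⁻¹ • ∑ j, X j
    obtain ⟨t, ht⟩ : ∃ t : ℝ, ∑ i, f i x ≤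
        ∑ i, f i (X i) + t * ipnd n d (blockPi n d X) (blockPi n d X) := by
      by_cases hq : ipnd n d (blockPi n d X) (blockPi n d X) = 0
      · have hX (i : Fin n) : X i = x :=
          sub_eq_zero.1 (congrFun (eq_zero_of_ipnd_self_eq_zero hq) i)
        exact ⟨0, by simp [hX]⟩
      · refine ⟨(∑ i, f i x - ∑ i, f i (X i)) /
          ipnd n d (blockPi n d X) (blockPi n d X), ?_⟩
        rw [div_mul_cancel₀ _ hq]
        linarith
    refine (iInf_le _ x).trans <| le_iSup_of_le (-(blockPi n d (t • X) + ν • X)) <|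
      le_iSup_of_le (t • X) <| EReal.coe_le_coe_iff.2 ?_
    rw [ipnd_complete_square n d hν.ne', blockPi_smul, ipnd_smul_right, ipnd_blockPi_self hn0]
    have h0 : t • blockPi n d X + -(t • blockPi n d X + ν • X) + ν • X = 0 := by abel
    rw [h0, ipnd_zero_zero, mul_zero, sub_zero]
    exact ht
  · refine le_iInf fun x => iInf_le_of_le (fun _ => x) <| iSup_le fun Y => iSup_le fun Z =>
      EReal.coe_le_coe_iff.2 ?_
    rw [ipnd_complete_square n d hν.ne', ipnd_const_blockPi hn0, add_zero]
    exact sub_le_self _ (mul_nonneg (by positivity) (ipnd_self_nonneg n d _))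
end
end

section
/- Let H be a finite-dimensional real inner product space and F : H → ℝ a convex differentiable function that is L-smooth, i.e. d_F(a,b) ≤ (L/2)‖a−b‖² for all a,b, where d_F(a,b) = F(a) − F(b) − ⟨∇F(b), a−b⟩ is the Bregman divergence. Let x, x̃, x*, ỹ ∈ H, set y* = ∇F(x*), and for real constants γ, γ̃ define x⁺ = x − γ(∇F(x) − ỹ) and x̃⁺ = x̃ − γ̃(∇F(x) − ỹ). Then for any constants A ≥ 0, Ã ≥ 0, η ∈ ℝ, η̃ ≥ 0: A(d_F(x⁺,x*) − d_F(x,x*)) + Ã(‖x̃⁺−x*‖² − ‖x̃−x*‖²) + ηA⟨x̃−x, ∇F(x)−∇F(x*)⟩ + 2η̃Ã⟨x−x̃, x̃−x*⟩ ≤ (A·Lγ²/2 − Aγ + Ãγ̃²)·‖∇F(x)−ỹ‖² + Aγ⟨∇F(x)−ỹ, y*−ỹ⟩ + 2γ̃Ã⟨ỹ−y*, x̃−x*⟩ − 2γ̃Ã(d_F(x̃,x*) + d_F(x*,x) − d_F(x̃,x)) − ηA(d_F(x̃,x) + d_F(x,x*) − d_F(x̃,x*)) − η̃Ã‖x̃−x*‖²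 + η̃Ã‖x−x*‖². -/
open RealInnerProductSpace

noncomputable section

/-- Bregman divergence `d_F(a,b) = F(a) - F(b) - ⟨∇F(b), a-b⟩`, with the gradient of `F`
given by the map `g`. -/
def bregman {H : Type*} [NormedAddCommGroup H] [InnerProductSpace ℝ H]
    (F : H → ℝ) (g : H → H) (a b : H) : ℝ :=
  F a - F b - ⟪g b, a - b⟫

section BregmanLemmas

variable {H : Type*} [NormedAddCommGroup H] [InnerProductSpace ℝ H]

/-- Three-point identity for the Bregman divergence. -/
lemma bregman_add_sub_bregman (F : H → ℝ) (g : H → H) (a b c : H) :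
    bregman F g a b + bregman F g b c - bregman F g a c = ⟪g c - g b, a - b⟫ := by
  simp only [bregman, inner_sub_left, inner_sub_right]
  ring

/-- Change of the Bregman divergence along a step `x - γ • v`, when the divergence has a
quadratic upper bound. -/
lemma bregman_step_sub_le {F : H → ℝ} {g : H → H} {L : ℝ}
    (hsmooth : ∀ a b : H, bregman F g a b ≤ L / 2 * ‖a - b‖ ^ 2) (x z v : H) (γ : ℝ) :
    bregman F g (x - γ • v) z - bregman F g x z ≤
      L * γ ^ 2 / 2 * ‖v‖ ^ 2 - γ * ⟪g x - g z, v⟫ := by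
  have h := hsmooth (x - γ • v) x
  have hn : ‖x - γ • v - x‖ ^ 2 = γ ^ 2 * ‖v‖ ^ 2 := by
    rw [sub_sub_cancel_left, norm_neg, norm_smul, mul_pow, Real.norm_eq_abs, sq_abs]
  rw [hn] at h
  simp only [bregman, inner_sub_left, inner_sub_right, real_inner_smul_right] at h ⊢
  linarith

/-- Expansion of the squared distance to `z` after a step `x - γ • v`. -/
lemma norm_step_sub_sq (x z v : H) (γ : ℝ) :
    ‖x - γ • v - z‖ ^ 2 = ‖x - z‖ ^ 2 - 2 * γ * ⟪v, x - z⟫ + γ ^ 2 * ‖v‖ ^ 2 := by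
  rw [sub_right_comm, norm_sub_sq_real, real_inner_smul_right, real_inner_comm, norm_smul,
    mul_pow, Real.norm_eq_abs, sq_abs]
  ring

end BregmanLemmas

theorem stmt16 {H : Type*} [NormedAddCommGroup H] [InnerProductSpace ℝ H]
    [FiniteDimensional ℝ H]
    (F : H → ℝ) (g : H → H) (L : ℝ)
    (hconv : ConvexOn ℝ Set.univ F)
    (hgrad : ∀ x, HasGradientAt F (g x) x)
    (hsmooth : ∀ a b : H, bregman F g a b ≤ L / 2 * ‖a - b‖ ^ 2)
    (x xt xs yt : H) (γ γt A At η ηt : ℝ)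
    (hA : 0 ≤ A) (hAt : 0 ≤ At) (hηt : 0 ≤ ηt) :
    A * (bregman F g (x - γ • (g x - yt)) xs - bregman F g x xs) +
      At * (‖(xt - γt • (g x - yt)) - xs‖ ^ 2 - ‖xt - xs‖ ^ 2) +
      η * A * ⟪xt - x, g x - g xs⟫ +
      2 * ηt * At * ⟪x - xt, xt - xs⟫ ≤
    (A * (L * γ ^ 2 / 2) - A * γ + At * γt ^ 2) * ‖g x - yt‖ ^ 2 +
      A * γ * ⟪g x - yt, g xs - yt⟫ +
      2 * γt * At * ⟪yt - g xs, xt - xs⟫ -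
      2 * γt * At * (bregman F g xt xs + bregman F g xs x - bregman F g xt x) -
      η * A * (bregman F g xt x + bregman F g x xs - bregman F g xt xs) -
      ηt * At * ‖xt - xs‖ ^ 2 + ηt * At * ‖x - xs‖ ^ 2 := by
  have h_grad := mul_le_mul_of_nonneg_left
    (bregman_step_sub_le hsmooth x xs (g x - yt) γ) hA
  have h_inner : ⟪g x - g xs, g x - yt⟫ = ‖g x - yt‖ ^ 2 - ⟪g x - yt, g xs - yt⟫ := by
    rw [← real_inner_self_eq_norm_sq, real_inner_comm, ← inner_sub_right, sub_sub_sub_cancel_right]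
  have h_split : ⟪g x - yt, xt - xs⟫ = ⟪g x - g xs, xt - xs⟫ - ⟪yt - g xs, xt - xs⟫ := by
    rw [← inner_sub_left, sub_sub_sub_cancel_right]
  have h_eta : bregman F g xt x + bregman F g x xs - bregman F g xt xs =
      -⟪xt - x, g x - g xs⟫ := by
    rw [bregman_add_sub_bregman, real_inner_comm, ← inner_neg_right, neg_sub]
  have h_norm : ‖x - xs‖ ^ 2 =
      ‖x - xt‖ ^ 2 + 2 * ⟪x - xt, xt - xs⟫ + ‖xt - xs‖ ^ 2 := by
    rw [← norm_add_sq_real, sub_add_sub_cancel]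
  have h_drop : 0 ≤ ηt * At * ‖x - xt‖ ^ 2 := by positivity
  rw [norm_step_sub_sq, bregman_add_sub_bregman, h_eta, h_split, h_norm]
  rw [h_inner] at h_grad
  linarith
end
end

section
/- Let H be a finite-dimensional real inner product space and F : H → ℝ differentiable. Let x, x̃, x*, y, ỹ, z, z* ∈ H with y* = ∇F(x*) and suppose the optimality relation y* + z* + νx* = 0 holds for a real constant ν. Let δ, δ̃, θ, α be real constants and B, B̃ constants with B̃ ≥ 0, αB ≥ 0 and αB = (δ/2)B̃. Define ỹ⁺ = ỹ + (δ+δ̃)(∇F(x) − ỹ). Then: B̃(‖ỹ⁺−y*‖² − ‖ỹ−y*‖²) + 2αB⟨y−y*, ỹ−y⟩ − 2θB̃⟨y+z+νx̃, ỹ−y*⟩ ≤ −(δ/2)B̃‖ỹ−y*‖² − (δ/2)B̃‖y−y*‖² − 2δ̃B̃⟨∇F(x)−ỹ, y*−ỹ⟩ + δB̃‖∇F(x)−∇F(x*)‖² + ((δ+δ̃)² − δ)B̃‖∇F(x)−ỹ‖² − 2θB̃⟨y+z−y*−z*, ỹ−y*⟩ − 2θνB̃⟨x̃−x*, ỹ−y*⟩.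 -/
open RealInnerProductSpace

noncomputable section

theorem stmt17 {H : Type*} [NormedAddCommGroup H] [InnerProductSpace ℝ H]
    [FiniteDimensional ℝ H]
    (F : H → ℝ) (g : H → H)
    (hgrad : ∀ x, HasGradientAt F (g x) x)
    (x xt xs y yt z zs : H) (ν : ℝ)
    (hopt : g xs + zs + ν • xs = 0)
    (δ δt θ α B Bt : ℝ) (hBt : 0 ≤ Bt) (hαB : 0 ≤ α * B)
    (hrel : α * B = δ / 2 * Bt) :
    Bt * (‖(yt + (δ + δt) • (g x - yt)) - g xs‖ ^ 2 - ‖yt - g xs‖ ^ 2) +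
      2 * α * B * ⟪y - g xs, yt - y⟫ -
      2 * θ * Bt * ⟪y + z + ν • xt, yt - g xs⟫ ≤
    -(δ / 2) * Bt * ‖yt - g xs‖ ^ 2 - δ / 2 * Bt * ‖y - g xs‖ ^ 2 -
      2 * δt * Bt * ⟪g x - yt, g xs - yt⟫ +
      δ * Bt * ‖g x - g xs‖ ^ 2 +
      ((δ + δt) ^ 2 - δ) * Bt * ‖g x - yt‖ ^ 2 -
      2 * θ * Bt * ⟪y + z - g xs - zs, yt - g xs⟫ -
      2 * θ * ν * Bt * ⟪xt - xs, yt - g xs⟫ := by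
  obtain ⟨e, he⟩ : ∃ e, e = yt - g xs := ⟨_, rfl⟩
  obtain ⟨d, hd⟩ : ∃ d, d = g x - yt := ⟨_, rfl⟩
  obtain ⟨w, hw⟩ : ∃ w, w = y - g xs := ⟨_, rfl⟩
  have hupdate : yt + (δ + δt) • (g x - yt) - g xs = e + (δ + δt) • d := by
    rw [he, hd]; abel
  have hdiff : yt - y = e - w := by rw [he, hw]; abel
  have hneg : g xs - yt = -e := by rw [he]; abel
  have hsum : g x - g xs = d + e := by rw [he, hd]; abel
  have hsaddle : y + z + ν • xt = (y + z - g xs - zs) + ν • (xt - xs) := by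
    rw [← sub_eq_zero, ← hopt, smul_sub]; abel
  rw [hupdate, hdiff, hneg, hsum, hsaddle, ← he, ← hd, ← hw, inner_add_left,
    real_inner_smul_left, norm_add_sq_real, norm_add_sq_real, norm_smul, inner_neg_right,
    inner_sub_right, real_inner_smul_right, real_inner_self_eq_norm_sq, mul_pow,
    Real.norm_eq_abs, sq_abs, real_inner_comm d e]
  have hsq : 0 ≤ α * B * ‖e - w‖ ^ 2 := mul_nonneg hαB (sq_nonneg _)
  rw [norm_sub_sq_real, real_inner_comm, hrel] at hsq
  rw [mul_assoc 2 α B, hrel]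
  linarith
end
end
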